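/- Let m > 0 and let w, k be real numbers with 0 ≤ w ≤ k and k > 0. Then ∫_0^{k^m − w^m} s·(k^m − s)^{(1−m)/m} ds ≥ (1/2)·min(w^{1−m}, k^{1−m})·(k^m − w^m)², where for m < 1 and w = 0 the right-hand side is interpreted as 0. -/

import Mathlib

open MeasureTheory

theorem min_rpow_one_sub_le {m w k t : ℝ} (hm : 0 < m) (hw : 0 ≤ w) (hk : 0 ≤ k)
    (ht : 0 < t) (hwt : w ^ m ≤ t) (htk : t ≤ k ^ m) :
    min (w ^ (1 - m)) (k ^ (1 - m)) ≤ t ^ ((1 - m) / m) := by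
  have hroot : t ^ ((1 - m) / m) = (t ^ m⁻¹) ^ (1 - m) := by
    rw [← Real.rpow_mul ht.le, div_eq_inv_mul]
  rw [hroot]
  rcases le_total m 1 with h | h
  · exact (min_le_left _ _).trans (Real.rpow_le_rpow hw
      ((Real.le_rpow_inv_iff_of_pos hw ht.le hm).2 hwt) (sub_nonneg.2 h))
  · exact (min_le_right _ _).trans (Real.rpow_le_rpow_of_nonpos (Real.rpow_pos_of_pos ht _)
      ((Real.rpow_inv_le_iff_of_pos ht.le hk hm).2 htk) (sub_nonpos.2 h))


/-- quadratic lower bound on the parabolic weight `g₋`: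
`∫_0^{k^m − w^m} s·(k^m − s)^{(1−m)/m} ds ≥ (1/2)·min(w^{1−m}, k^{1−m})·(k^m − w^m)²`.
(For `m < 1` and `w = 0` the real power `w^{1−m}` equals `0`, so the right-hand
side is `0`, as stipulated.) -/
theorem g_minus_quadratic_lower_bound (m w k : ℝ) (hm : 0 < m)
    (hw : 0 ≤ w) (hwk : w ≤ k) (hk : 0 < k) :
    1 / 2 * min (w ^ (1 - m)) (k ^ (1 - m)) * (k ^ m - w ^ m) ^ 2
      ≤ ∫ s in (0:ℝ)..(k ^ m - w ^ m), s * (k ^ m - s) ^ ((1 - m) / m) := by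
  have hwm : 0 ≤ w ^ m := Real.rpow_nonneg hw m
  have hL : 0 ≤ k ^ m - w ^ m := sub_nonneg.2 (Real.rpow_le_rpow hw hwk hm.le)
  have hp : -1 < (1 - m) / m := by
    rw [lt_div_iff₀ hm]
    linarith
  have hint : IntervalIntegrable (fun s : ℝ => (k ^ m - s) ^ ((1 - m) / m)) volume
      0 (k ^ m - w ^ m) := by
    have h := (intervalIntegral.intervalIntegrable_rpow' (a := k ^ m) (b := w ^ m)
      hp).comp_sub_left (k ^ m)
    simpa using h
  have hint' : IntervalIntegrable (fun s : ℝ => s * (k ^ m - s) ^ ((1 - m) / m)) volume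
      0 (k ^ m - w ^ m) := hint.continuousOn_mul continuousOn_id
  have hlin : IntervalIntegrable (fun s : ℝ => s * min (w ^ (1 - m)) (k ^ (1 - m))) volume
      0 (k ^ m - w ^ m) := (by fun_prop : Continuous _).intervalIntegrable _ _
  calc 1 / 2 * min (w ^ (1 - m)) (k ^ (1 - m)) * (k ^ m - w ^ m) ^ 2
      = ∫ s in (0:ℝ)..(k ^ m - w ^ m), s * min (w ^ (1 - m)) (k ^ (1 - m)) := by
        rw [intervalIntegral.integral_mul_const, integral_id]
        ring
    _ ≤ _ := by
        refine intervalIntegral.integral_mono_on_of_le_Ioo hL hlin hint' fun s hs => ?_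
        refine mul_le_mul_of_nonneg_left ?_ hs.1.le
        have hws : w ^ m ≤ k ^ m - s := by linarith [hs.2]
        have hsk : k ^ m - s ≤ k ^ m := by linarith [hs.1]
        have hpos : 0 < k ^ m - s := by linarith [hs.2]
        exact min_rpow_one_sub_le hm hw hk.le hpos hws hsk
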